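/- Let d ≥ 2 be an integer and let p, φ ∈ ℂ[z] be polynomials satisfying φ(p(z)) = φ(z)^d for all z ∈ ℂ. Define q(z,w) = D_d(w, φ(z)) and, for n ≥ 1, the fiberwise composition Q_zⁿ = q_{p^{n−1}(z)} ∘ ⋯ ∘ q_z where q_z(w) = q(z,w). Then for every n ≥ 1 and every z ∈ ℂ, Q_zⁿ(w) = D_{dⁿ}(w, φ(z)) as a polynomial in w. Moreover, if z is a periodic point of p with pⁿ(z) = z and φ(z) ≠ 0, then φ(z)^{dⁿ−1} = 1 and Q_zⁿ is affinely conjugate to T_{dⁿ} or −T_{dⁿ}, while if φ(z) = 0 then Q_zⁿ(w) = w^{dⁿ}. -/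

import Mathlib

open Polynomial

noncomputable section

/-- The Chebyshev polynomial `T_d` of the paper, `T_d(x) = D_d(x, 1)`. -/
def ChebT (d : ℕ) : Polynomial ℂ := dickson 1 1 d

/-- `f` is affinely conjugate to `g`: `f = L⁻¹ ∘ g ∘ L` for an affine map `L(x) = ux + v`, `u ≠ 0`. -/
def AffConj (f g : Polynomial ℂ) : Prop :=
  ∃ u v : ℂ, u ≠ 0 ∧ f = (C u⁻¹ * (X - C v)).comp (g.comp (C u * X + C v))

/-- `polyIter p n = pⁿ`, the `n`-fold composition of `p` (with `p⁰ = X`). -/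
def polyIter (p : Polynomial ℂ) : ℕ → Polynomial ℂ
  | 0 => X
  | n + 1 => (polyIter p n).comp p

/-- The fiberwise composition `Q_zⁿ = q_{pⁿ⁻¹(z)} ∘ ⋯ ∘ q_z` for `q_z(w) = D_d(w, φ(z))`,
via the recursion `Q_z⁰ = id`, `Q_z^(n+1) = Q_{p(z)}ⁿ ∘ q_z`. -/
def QIterD (d : ℕ) (p φ : Polynomial ℂ) : ℕ → ℂ → Polynomial ℂ
  | 0, _ => X
  | n + 1, z => (QIterD d p φ n (p.eval z)).comp (dickson 1 (φ.eval z) d)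

theorem dickson_one_mul_eval_add {R : Type*} [CommRing R] (x y : R) :
    ∀ n : ℕ, (dickson 1 (x * y) n).eval (x + y) = x ^ n + y ^ n
  | 0 => by
    simp only [pow_zero, dickson_zero]; norm_num
  | 1 => by simp
  | n + 2 => by
    simp only [dickson_add_two, eval_sub, eval_mul, eval_X, eval_C,
      dickson_one_mul_eval_add x y (n + 1), dickson_one_mul_eval_add x y n]
    ring

theorem exists_add_eq_mul_eq {K : Type*} [Field K] [IsAlgClosed K] (s a : K) :
    ∃ x y : K, x + y = s ∧ x * y = a := by
  have hdeg : (X ^ 2 - C s * X + C a : K[X]).degree = 2 := by compute_degree!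
  obtain ⟨x, hx⟩ := IsAlgClosed.exists_root (X ^ 2 - C s * X + C a : K[X]) (by rw [hdeg]; decide)
  simp only [IsRoot.def, eval_add, eval_sub, eval_pow, eval_mul, eval_X, eval_C] at hx
  exact ⟨x, s - x, by ring, by linear_combination -hx⟩

theorem dickson_one_mul_eq_comp {K : Type*} [Field K] [IsAlgClosed K] (a : K) (m n : ℕ) :
    dickson 1 a (m * n) = (dickson 1 (a ^ n) m).comp (dickson 1 a n) := by
  have := IsAlgClosed.instInfinite (K := K)
  refine Polynomial.funext fun w => ?_
  obtain ⟨x, y, rfl, rfl⟩ := exists_add_eq_mul_eq w a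
  rw [eval_comp, dickson_one_mul_eval_add, dickson_one_mul_eval_add, mul_pow,
    dickson_one_mul_eval_add]
  ring

theorem dickson_one_zero_right {R : Type*} [CommRing R] :
    ∀ n : ℕ, n ≠ 0 → dickson 1 (0 : R) n = X ^ n
  | 0, h => absurd rfl h
  | 1, _ => by simp
  | n + 2, _ => by
    rw [dickson_add_two, dickson_one_zero_right (n + 1) n.succ_ne_zero]
    simp only [map_zero, zero_mul, sub_zero]
    ring

theorem dickson_one_sq_eval_mul {R : Type*} [CommRing R] (c x : R) :
    ∀ n : ℕ, (dickson 1 (c ^ 2) n).eval (c * x) = c ^ n * (dickson 1 1 n).eval x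
  | 0 => by
    simp only [pow_zero, dickson_zero, one_mul]; norm_num
  | 1 => by simp
  | n + 2 => by
    simp only [dickson_add_two, eval_sub, eval_mul, eval_X, eval_C,
      dickson_one_sq_eval_mul c x (n + 1), dickson_one_sq_eval_mul c x n]
    ring

theorem affConj_dickson_one_sq {c : ℂ} (hc : c ≠ 0) {N : ℕ} {g : ℂ[X]}
    (hg : C c * g = C (c ^ N) * ChebT N) : AffConj (dickson 1 (c ^ 2) N) g := by
  refine ⟨c⁻¹, 0, inv_ne_zero hc, Polynomial.funext fun w => ?_⟩
  have hw : c * (c⁻¹ * w) = w := mul_inv_cancel_left₀ hc w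
  have hscale := dickson_one_sq_eval_mul c (c⁻¹ * w) N
  have hgw := congrArg (eval (c⁻¹ * w)) hg
  rw [hw] at hscale
  simp only [eval_mul, eval_C, ChebT] at hgw
  simp [hscale, hgw]

theorem affConj_dickson_chebT_or_neg {a : ℂ} {N : ℕ} (hN : N ≠ 0) (h : a ^ (N - 1) = 1)
    (ha : a ≠ 0) :
    AffConj (dickson 1 a N) (ChebT N) ∨ AffConj (dickson 1 a N) (-ChebT N) := by
  obtain ⟨c, rfl⟩ : ∃ c, a = c ^ 2 :=
    (IsAlgClosed.exists_pow_nat_eq a two_pos).imp fun _ => Eq.symm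
  have hc : c ≠ 0 := by rintro rfl; simp at ha
  have hcN : c ^ N = c ^ (N - 1) * c := (pow_sub_one_mul hN c).symm
  rw [← pow_mul, mul_comm, pow_mul] at h
  rcases sq_eq_one_iff.mp h with h | h
  · exact .inl (affConj_dickson_one_sq hc (by rw [hcN, h, one_mul]))
  · exact .inr (affConj_dickson_one_sq hc (by rw [hcN, h]; simp))

theorem QIterD_eq_dickson {d : ℕ} {p φ : ℂ[X]}
    (h : ∀ z : ℂ, φ.eval (p.eval z) = φ.eval z ^ d) (n : ℕ) (z : ℂ) :
    QIterD d p φ n z = dickson 1 (φ.eval z) (d ^ n) := by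
  induction n generalizing z with
  | zero => simp [QIterD]
  | succ n ih => rw [QIterD, ih, h, pow_succ, dickson_one_mul_eq_comp]

theorem eval_eval_polyIter {d : ℕ} {p φ : ℂ[X]}
    (h : ∀ z : ℂ, φ.eval (p.eval z) = φ.eval z ^ d) (n : ℕ) (z : ℂ) :
    φ.eval ((polyIter p n).eval z) = φ.eval z ^ d ^ n := by
  induction n generalizing z with
  | zero => simp [polyIter]
  | succ n ih => rw [polyIter, eval_comp, ih, h, ← pow_mul, pow_succ']

/-- Let `d ≥ 2`, let `p, φ ∈ ℂ[z]` satisfy `φ(p(z)) = φ(z)^d`, and set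
`q(z,w) = D_d(w, φ(z))`. Then `Q_zⁿ(w) = D_{dⁿ}(w, φ(z))` for all `n ≥ 1` and `z ∈ ℂ`; moreover, if
`pⁿ(z) = z` then: if `φ(z) ≠ 0` then `φ(z)^(dⁿ−1) = 1` and `Q_zⁿ` is affinely conjugate to
`T_{dⁿ}` or `−T_{dⁿ}`, while if `φ(z) = 0` then `Q_zⁿ(w) = w^(dⁿ)`. -/
theorem stmt18 (d : ℕ) (hd : 2 ≤ d) (p φ : Polynomial ℂ)
    (h : ∀ z : ℂ, φ.eval (p.eval z) = φ.eval z ^ d) :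
    (∀ n : ℕ, 1 ≤ n → ∀ z : ℂ, QIterD d p φ n z = dickson 1 (φ.eval z) (d ^ n)) ∧
      ∀ n : ℕ, 1 ≤ n → ∀ z : ℂ, (polyIter p n).eval z = z →
        (φ.eval z ≠ 0 →
          φ.eval z ^ (d ^ n - 1) = 1 ∧
            (AffConj (QIterD d p φ n z) (ChebT (d ^ n)) ∨
              AffConj (QIterD d p φ n z) (-ChebT (d ^ n)))) ∧
        (φ.eval z = 0 → QIterD d p φ n z = X ^ d ^ n) := by
  refine ⟨fun n _ z => QIterD_eq_dickson h n z, fun n _ z hz => ?_⟩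
  have hN : d ^ n ≠ 0 := pow_ne_zero n (by lia)
  rw [QIterD_eq_dickson h]
  refine ⟨fun h0 => ?_, fun h0 => by rw [h0, dickson_one_zero_right _ hN]⟩
  have hper := eval_eval_polyIter h n z
  rw [hz, ← pow_sub_one_mul hN] at hper
  have hone : φ.eval z ^ (d ^ n - 1) = 1 := (right_eq_mul₀ h0).mp hper
  exact ⟨hone, affConj_dickson_chebT_or_neg hN hone h0⟩
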